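/- (Dependent random choice) Let G be a bipartite graph with parts V_1, V_2 each of size n/2, let d = 2|E(G)|/n, and let a, b, r be positive integers satisfying d^r / n^{r−1} − C(n, r)·((b−1)/n)^r ≥ a. Then there exists a subset A_0 ⊆ V_1 with |A_0| ≥ a such that every r vertices of A_0 have at least b common neighbors in V_2. -/

import Mathlib

theorem drc_choose (m : ℕ) (r : ℕ) : m.choose r * 2 ^ r ≤ (2 * m).choose r := by
  have h : m.descFactorial r * 2 ^ r ≤ (2 * m).descFactorial r := by
    induction r with
    | zero => simp
    | succ k ih =>
      rw [Nat.descFactorial_succ, Nat.descFactorial_succ, pow_succ]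
      calc (m - k) * m.descFactorial k * (2 ^ k * 2)
          = (2 * (m - k)) * (m.descFactorial k * 2 ^ k) := by ring
        _ ≤ _ := Nat.mul_le_mul (by omega) ih
  rw [Nat.descFactorial_eq_factorial_mul_choose, Nat.descFactorial_eq_factorial_mul_choose,
    mul_assoc] at h
  exact Nat.le_of_mul_le_mul_left h (Nat.factorial_pos r)

theorem drc_alter {V : Type*} [DecidableEq V] (A : Finset V) (B : Finset (Finset V))
    (hB : ∀ S ∈ B, S.Nonempty) :
    ∃ A₀ ⊆ A, A.card ≤ A₀.card + B.card ∧ ∀ S ∈ B, ¬ S ⊆ A₀ := by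
  classical
  rcases B.eq_empty_or_nonempty with rfl | ⟨S₀, hS₀⟩
  · exact ⟨A, Finset.Subset.refl A, by simp, by simp⟩
  obtain ⟨v₀, -⟩ := hB S₀ hS₀
  have : Nonempty V := ⟨v₀⟩
  choose! f hf using hB
  refine ⟨A \ B.image f, Finset.sdiff_subset, ?_, ?_⟩
  · have h1 := Finset.le_card_sdiff (B.image f) A
    have h2 : (B.image f).card ≤ B.card := Finset.card_image_le
    omega
  · intro S hS hsub
    have := hsub (hf S hS)
    simp only [Finset.mem_sdiff, Finset.mem_image, not_exists, not_and] at this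
    exact this.2 S hS rfl

theorem drc_arith (e m a k c C : ℕ) (b s : ℝ) (hm : 0 < m) (hb : 0 ≤ b)
    (hc : c * 2 ^ (k + 1) ≤ C) (hs : (e : ℝ) ^ (k + 1) / (m : ℝ) ^ k ≤ s)
    (h : ((2 * e : ℝ) / ((2 * m : ℕ) : ℝ)) ^ (k + 1) / ((2 * m : ℕ) : ℝ) ^ k
      - (C : ℝ) * (b / ((2 * m : ℕ) : ℝ)) ^ (k + 1) ≥ a) :
    (a : ℝ) * (m : ℝ) ^ (k + 1) ≤ s - c * b ^ (k + 1) := by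
  have hm' : (0 : ℝ) < m := by exact_mod_cast hm
  have hc' : (c : ℝ) * 2 ^ (k + 1) ≤ C := by exact_mod_cast hc
  push_cast at h
  have e1 : ((2 * e : ℝ) / (2 * m)) ^ (k + 1) / (2 * m : ℝ) ^ k * (m : ℝ) ^ (k + 1)
      = (e : ℝ) ^ (k + 1) / (m : ℝ) ^ k / 2 ^ k := by
    rw [mul_div_mul_left _ _ (two_ne_zero), div_pow, mul_pow]
    field_simp
  have e2 : (C : ℝ) * (b / (2 * m)) ^ (k + 1) * (m : ℝ) ^ (k + 1)
      = C / 2 ^ (k + 1) * b ^ (k + 1) := by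
    rw [div_pow, mul_pow]
    field_simp
  have h2 := mul_le_mul_of_nonneg_right h.le (pow_nonneg hm'.le (k + 1))
  rw [sub_mul, e1, e2] at h2
  have h3 : (e : ℝ) ^ (k + 1) / (m : ℝ) ^ k / 2 ^ k ≤ (e : ℝ) ^ (k + 1) / (m : ℝ) ^ k :=
    div_le_self (by positivity) (one_le_pow₀ (by norm_num))
  have h4 : (c : ℝ) * b ^ (k + 1) ≤ C / 2 ^ (k + 1) * b ^ (k + 1) := by
    gcongr
    rw [le_div_iff₀ (by positivity)]
    exact hc'
  linarith

theorem drc_count {V : Type*} [Fintype V] [DecidableEq V]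
    (P : V → Prop) [DecidablePred P] (V₂ : Finset V) (r : ℕ) :
    ((Fintype.piFinset (fun _ : Fin r => V₂)).filter (fun T => ∀ i, P (T i))).card
      = (V₂.filter P).card ^ r := by
  have : (Fintype.piFinset (fun _ : Fin r => V₂)).filter (fun T => ∀ i, P (T i))
      = Fintype.piFinset (fun _ : Fin r => V₂.filter P) := by
    ext T
    simp [Fintype.mem_piFinset, forall_and]
  rw [this]
  simp

/-- Dependent random choice: in a bipartite graph on balanced parts of total
size `n` with average degree `d = 2|E|/n`, if
`d^r / n^(r-1) - C(n,r) * ((b-1)/n)^r ≥ a`, then there is `A₀ ⊆ V₁` of size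
at least `a` such that every `r` vertices of `A₀` have at least `b` common
neighbors in `V₂`. -/
theorem stmt_10 {V : Type*} [Fintype V] [DecidableEq V]
    (G : SimpleGraph V) [DecidableRel G.Adj]
    (V₁ V₂ : Finset V) (n : ℕ) (hn : 0 < n)
    (hdisj : Disjoint V₁ V₂) (hcover : V₁ ∪ V₂ = Finset.univ)
    (hcard₁ : 2 * V₁.card = n) (hcard₂ : 2 * V₂.card = n)
    (hbip : ∀ u v : V, G.Adj u v →
      (u ∈ V₁ ∧ v ∈ V₂) ∨ (u ∈ V₂ ∧ v ∈ V₁))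
    (a b r : ℕ) (ha : 0 < a) (hb : 0 < b) (hr : 0 < r)
    (hineq : ((2 * G.edgeFinset.card : ℝ) / n) ^ r / (n : ℝ) ^ (r - 1)
        - (n.choose r : ℝ) * (((b : ℝ) - 1) / n) ^ r ≥ (a : ℝ)) :
    ∃ A₀ : Finset V, A₀ ⊆ V₁ ∧ a ≤ A₀.card ∧
      ∀ S : Finset V, S ⊆ A₀ → S.card = r →
        b ≤ (V₂.filter (fun y => ∀ x ∈ S, G.Adj x y)).card := by
  classical
  obtain ⟨k, rfl⟩ : ∃ k, r = k + 1 := ⟨r - 1, by omega⟩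
  set m := V₁.card with hm
  have hm2 : V₂.card = m := by omega
  have hmpos : 0 < m := by omega
  subst hcard₁
  simp only [Nat.add_sub_cancel] at hineq
  set deg : V → ℕ := fun x => (V₂.filter (fun y => G.Adj x y)).card with hdeg
  -- edge count
  have hB : G.IsBipartiteWith (V₁ : Set V) (V₂ : Set V) :=
    ⟨by exact_mod_cast hdisj, fun u v h => by simpa using hbip u v h⟩
  have hedge : ∑ x ∈ V₁, deg x = G.edgeFinset.card := by
    rw [← SimpleGraph.isBipartiteWith_sum_degrees_eq_card_edges hB]
    refine Finset.sum_congr rfl fun x hx => ?_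
    rw [← SimpleGraph.card_neighborFinset_eq_degree]
    refine congrArg Finset.card ?_
    ext y
    simp only [Finset.mem_filter, SimpleGraph.mem_neighborFinset, and_iff_right_iff_imp]
    intro hxy
    rcases hbip x y hxy with h | h
    · exact h.2
    · exact absurd h.1 (Finset.disjoint_left.mp hdisj hx)
  have hpow : (G.edgeFinset.card : ℝ) ^ (k + 1) / (m : ℝ) ^ k
      ≤ ∑ x ∈ V₁, (deg x : ℝ) ^ (k + 1) := by
    rw [← hedge]
    push_cast
    exact pow_sum_div_card_le_sum_pow (s := V₁) (f := fun x => (deg x : ℝ)) (fun _ _ => by positivity) k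
  have hb1 : (0 : ℝ) ≤ (b : ℝ) - 1 := by
    have : (1 : ℝ) ≤ b := by exact_mod_cast hb
    linarith
  have key := drc_arith _ m a k (m.choose (k + 1)) _ _ _ hmpos hb1 (drc_choose m (k + 1)) hpow hineq
  set Ts := Fintype.piFinset (fun _ : Fin (k + 1) => V₂) with hTs
  set N : Finset V → Finset V := fun S => V₂.filter (fun y => ∀ x ∈ S, G.Adj x y) with hN
  set Bad := (V₁.powersetCard (k + 1)).filter (fun S => (N S).card < b) with hBad
  set A : (Fin (k + 1) → V) → Finset V := fun T => V₁.filter (fun x => ∀ i, G.Adj x (T i)) with hA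
  set BT : (Fin (k + 1) → V) → Finset (Finset V) :=
    fun T => Bad.filter (fun S => ∀ i, ∀ x ∈ S, G.Adj x (T i)) with hBT
  have hTcard : Ts.card = m ^ (k + 1) := by simp [hTs, hm2]
  have s1 : ∑ T ∈ Ts, (A T).card = ∑ x ∈ V₁, deg x ^ (k + 1) := by
    rw [hA]
    simp only [Finset.card_filter]
    rw [Finset.sum_comm]
    refine Finset.sum_congr rfl fun x _ => ?_
    rw [← Finset.card_filter]
    exact drc_count (fun y => G.Adj x y) V₂ (k + 1)
  have s2 : ∑ T ∈ Ts, (BT T).card = ∑ S ∈ Bad, (N S).card ^ (k + 1) := by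
    rw [hBT]
    simp only [Finset.card_filter]
    rw [Finset.sum_comm]
    refine Finset.sum_congr rfl fun S _ => ?_
    rw [← Finset.card_filter]
    exact drc_count (fun y => ∀ x ∈ S, G.Adj x y) V₂ (k + 1)
  have s3 : ∑ S ∈ Bad, ((N S).card : ℝ) ^ (k + 1) ≤ m.choose (k + 1) * ((b : ℝ) - 1) ^ (k + 1) := by
    calc ∑ S ∈ Bad, ((N S).card : ℝ) ^ (k + 1) ≤ ∑ S ∈ Bad, ((b : ℝ) - 1) ^ (k + 1) := by
          refine Finset.sum_le_sum fun S hS => ?_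
          have h1 : (N S).card + 1 ≤ b := (Finset.mem_filter.mp hS).2
          have h2 : ((N S).card : ℝ) + 1 ≤ b := by exact_mod_cast h1
          gcongr
          linarith
      _ = Bad.card * ((b : ℝ) - 1) ^ (k + 1) := by simp
      _ ≤ _ := by
          gcongr
          rw [hm, ← Finset.card_powersetCard]
          exact Finset.card_filter_le _ _
  have hsum : ∑ T ∈ Ts, (a : ℝ) ≤ ∑ T ∈ Ts, (((A T).card : ℝ) - (BT T).card) := by
    have t1 : ∑ T ∈ Ts, ((A T).card : ℝ) = ∑ x ∈ V₁, (deg x : ℝ) ^ (k + 1) := by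
      exact_mod_cast s1
    have t2 : ∑ T ∈ Ts, ((BT T).card : ℝ) = ∑ S ∈ Bad, ((N S).card : ℝ) ^ (k + 1) := by
      exact_mod_cast s2
    rw [Finset.sum_sub_distrib, t1, t2, Finset.sum_const, hTcard, nsmul_eq_mul]
    push_cast
    linarith
  have hne : Ts.Nonempty := by
    rw [← Finset.card_pos, hTcard]
    positivity
  obtain ⟨T, hT, hTa⟩ := Finset.exists_le_of_sum_le hne hsum
  have hTa' : a + (BT T).card ≤ (A T).card := by
    have : (a : ℝ) + (BT T).card ≤ (A T).card := by linarith
    exact_mod_cast this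
  obtain ⟨A₀, hsub, hc, hno⟩ := drc_alter (A T) (BT T) (by
    intro S hS
    have h1 := (Finset.mem_powersetCard.mp (Finset.mem_filter.mp (Finset.mem_filter.mp hS).1).1).2
    exact Finset.card_pos.mp (by omega))
  have hsub1 : A₀ ⊆ V₁ := hsub.trans (Finset.filter_subset _ _)
  refine ⟨A₀, hsub1, by omega, fun S hS hSc => ?_⟩
  by_contra hlt
  refine hno S ?_ hS
  refine Finset.mem_filter.mpr ⟨Finset.mem_filter.mpr
    ⟨Finset.mem_powersetCard.mpr ⟨hS.trans hsub1, hSc⟩, not_le.mp hlt⟩, ?_⟩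
  intro i x hx
  exact (Finset.mem_filter.mp (hsub (hS hx))).2 i
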